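/- arXiv:2503.02290 — 3 statements merged into one kernel-verified Lean document; each statement's English description precedes it below -/
import Mathlib

section
/- Let X be a countably infinite Hausdorff topological space that is zero-dimensional, Fréchet, and has uncountable π-character everywhere. Then nwd(X) ≰_K nwd, and ED ≰_K nwd(X)↾Y for every Y ∈ nwd(X)⁺. In other words, nwd(X) does not satisfy the Category Dichotomy. -/
open Cardinal Set

/-- An ideal on a (countably infinite) set: contains finite sets, not the whole set,
closed under subsets and finite unions. -/
def IsIdeal {α : Type*} (I : Set (Set α)) : Prop :=
  (∀ A : Set α, A.Finite → A ∈ I) ∧ (Set.univ ∉ I) ∧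
    (∀ A B : Set α, A ∈ I → B ⊆ A → B ∈ I) ∧
    (∀ A B : Set α, A ∈ I → B ∈ I → A ∪ B ∈ I)

/-- `J ≤_K I`: there is a function from the underlying set of `I` to that of `J`
pulling members of `J` back into `I`. -/
def KatetovLE {α β : Type*} (J : Set (Set β)) (I : Set (Set α)) : Prop :=
  ∃ f : α → β, ∀ A ∈ J, f ⁻¹' A ∈ I

def FiniteToOne {α β : Type*} (f : α → β) : Prop := ∀ b : β, (f ⁻¹' {b}).Finite

/-- `J ≤_KB I`: Katětov-Blass order (finite-to-one witness). -/
def KatetovBlassLE {α β : Type*} (J : Set (Set β)) (I : Set (Set α)) : Prop :=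
  ∃ f : α → β, FiniteToOne f ∧ ∀ A ∈ J, f ⁻¹' A ∈ I

/-- The restriction `I ↾ X`, as an ideal on the subtype `X`. -/
def restrictIdeal {α : Type*} (I : Set (Set α)) (X : Set α) : Set (Set ↥X) :=
  {A : Set ↥X | (Subtype.val '' A) ∈ I}

/-- The ideal generated by a family `G` together with the finite sets. -/
def genIdeal {α : Type*} (G : Set (Set α)) : Set (Set α) :=
  {A | ∃ (S : Finset (Set α)) (F : Set α), ↑S ⊆ G ∧ F.Finite ∧ A ⊆ F ∪ ⋃₀ ↑S}

/-- Generators of the eventually different ideal: columns and graphs of functions. -/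
def EDGenerators : Set (Set (ℕ × ℕ)) :=
  {C | ∃ n : ℕ, C = {p : ℕ × ℕ | p.1 = n}} ∪
    {G | ∃ f : ℕ → ℕ, G = {p : ℕ × ℕ | p.2 = f p.1}}

/-- The eventually different ideal on `ω × ω`. -/
def ED : Set (Set (ℕ × ℕ)) := genIdeal EDGenerators

/-- Generators of `fin × fin`: columns and regions under graphs. -/
def FinFinGenerators : Set (Set (ℕ × ℕ)) :=
  {C | ∃ n : ℕ, C = {p : ℕ × ℕ | p.1 = n}} ∪
    {D | ∃ f : ℕ → ℕ, D = {p : ℕ × ℕ | p.2 ≤ f p.1}}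

/-- The ideal `fin × fin` on `ω × ω`. -/
def FinTimesFin : Set (Set (ℕ × ℕ)) := genIdeal FinFinGenerators

def Delta : Set (ℕ × ℕ) := {p : ℕ × ℕ | p.2 ≤ p.1}

/-- `ED_fin`, the restriction of `ED` to `Δ = {(n,m) : m ≤ n}`. -/
def EDfin : Set (Set ↥Delta) := restrictIdeal ED Delta

/-- The ideal of nowhere dense subsets of the rationals. -/
def nwdQ : Set (Set ℚ) := {A : Set ℚ | IsNowhereDense A}

/-- The copy of a family of subsets of `α` inside the Cantor space `α → Bool`
(via characteristic functions). -/
def cantorCopy {α : Type*} (I : Set (Set α)) : Set (α → Bool) :=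
  {x : α → Bool | {a : α | x a = true} ∈ I}

def IsUltrafilterSet (U : Set (Set ℕ)) : Prop :=
  Set.univ ∈ U ∧ ∅ ∉ U ∧ (∀ A B : Set ℕ, A ∈ U → A ⊆ B → B ∈ U) ∧
    (∀ A B : Set ℕ, A ∈ U → B ∈ U → A ∩ B ∈ U) ∧
    (∀ A : Set ℕ, A ∈ U ∨ (Set.univ \ A) ∈ U)

def NonprincipalUF (U : Set (Set ℕ)) : Prop := ∀ A : Set ℕ, A.Finite → A ∉ U

/-- The dual ideal `U*` of an ultrafilter `U`. -/
def dualIdeal (U : Set (Set ℕ)) : Set (Set ℕ) := {A : Set ℕ | Set.univ \ A ∈ U}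

/-- `U` is a Ramsey ultrafilter. -/
def IsRamseyUF (U : Set (Set ℕ)) : Prop :=
  ∀ P : ℕ → Set ℕ, Pairwise (Function.onFun Disjoint P) → (⋃ n, P n) = Set.univ →
    (∀ n, P n ∉ U) → ∃ A ∈ U, ∀ n, (A ∩ P n).Subsingleton

def IsTight (I : Set (Set ℕ)) : Prop :=
  ∀ X : ℕ → Set ℕ, (∀ n, X n ∉ I) → ∃ Y ∈ I, ∀ n, (Y ∩ X n).Infinite

def IsPIdeal (I : Set (Set ℕ)) : Prop :=
  ∀ A : ℕ → Set ℕ, (∀ n, A n ∈ I) → ∃ B ∈ I, ∀ n, (A n \ B).Finite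

def IsPMinus (I : Set (Set ℕ)) : Prop :=
  ∀ X : Set ℕ, X ∉ I → ∀ Xs : ℕ → Set ℕ, (∀ n, Xs n ⊆ X) → (∀ n, X \ Xs n ∈ I) →
    ∃ Y : Set ℕ, Y ∉ I ∧ ∀ n, (Y \ Xs n).Finite

def IsQPlus (I : Set (Set ℕ)) : Prop :=
  ∀ X : Set ℕ, X ∉ I → ∀ P : ℕ → Set ℕ, (∀ n, (P n).Finite) →
    Pairwise (Function.onFun Disjoint P) → (⋃ n, P n) = X →
    ∃ A : Set ℕ, A ∉ I ∧ A ⊆ X ∧ ∀ n, (A ∩ P n).Subsingleton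

def AlmostSubset (A B : Set ℕ) : Prop := (A \ B).Finite

/-- The tower number 𝔱. -/
noncomputable def towerNumber : Cardinal :=
  sInf {c : Cardinal | ∃ T : Set (Set ℕ),
    (∀ A ∈ T, A.Infinite) ∧
    (∀ A ∈ T, ∀ B ∈ T, AlmostSubset A B ∨ AlmostSubset B A) ∧
    (¬ ∃ A : Set ℕ, A.Infinite ∧ ∀ B ∈ T, AlmostSubset A B) ∧
    Cardinal.mk T = c}

/-- cov(M): covering number of the meager ideal of Baire space. -/
noncomputable def covM : Cardinal :=
  sInf {c : Cardinal | ∃ F : Set (Set (ℕ → ℕ)),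
    (∀ A ∈ F, IsMeagre A) ∧ ⋃₀ F = Set.univ ∧ Cardinal.mk F = c}

/-- The dominating number 𝔡. -/
noncomputable def dNumber : Cardinal :=
  sInf {c : Cardinal | ∃ D : Set (ℕ → ℕ),
    (∀ f : ℕ → ℕ, ∃ g ∈ D, ∀ᶠ n in Filter.atTop, f n ≤ g n) ∧ Cardinal.mk D = c}

/-- The cofinality of an ideal: least size of a cofinal subfamily. -/
noncomputable def idealCof (I : Set (Set ℕ)) : Cardinal :=
  sInf {c : Cardinal | ∃ C : Set (Set ℕ), C ⊆ I ∧ (∀ A ∈ I, ∃ B ∈ C, A ⊆ B) ∧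
    Cardinal.mk C = c}

/-- An increasing interval partition of ω, given by its sequence of endpoints. -/
structure IncIntervalPartition where
  e : ℕ → ℕ
  zero : e 0 = 0
  mono : StrictMono e
  incr : ∀ n : ℕ, e (n + 1) - e n < e (n + 2) - e (n + 1)

def IncIntervalPartition.block (P : IncIntervalPartition) (n : ℕ) : Set ℕ :=
  Set.Ico (P.e n) (P.e (n + 1))

/-- A selector of an interval partition: a set meeting each block in exactly one point. -/
def IsSelector (P : IncIntervalPartition) (S : Set ℕ) : Prop :=
  ∀ n : ℕ, ∃! x : ℕ, x ∈ S ∩ P.block n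

/-- The ideal `ED_P` generated by the selectors of `P` (and the finite sets). -/
def EDP (P : IncIntervalPartition) : Set (Set ℕ) := genIdeal {S : Set ℕ | IsSelector P S}

/-- A Fréchet space: closure points are limits of sequences. -/
def IsFrechet (α : Type*) [TopologicalSpace α] : Prop :=
  ∀ (a : α) (Y : Set α), a ∈ closure Y →
    ∃ u : ℕ → α, (∀ n, u n ∈ Y) ∧ Filter.Tendsto u Filter.atTop (nhds a)

/-- Zero-dimensional: the clopen sets form a basis. -/
def ZeroDimensional (α : Type*) [TopologicalSpace α] : Prop :=
  TopologicalSpace.IsTopologicalBasis {U : Set α | IsClopen U}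

/-- A local π-base at a point. -/
def IsLocalPiBase {α : Type*} [TopologicalSpace α] (B : Set (Set α)) (b : α) : Prop :=
  (∀ U ∈ B, IsOpen U ∧ U.Nonempty) ∧
    ∀ V : Set α, IsOpen V → b ∈ V → ∃ U ∈ B, U ⊆ V

/-- Every point has uncountable π-character. -/
def UncountablePiCharEverywhere (α : Type*) [TopologicalSpace α] : Prop :=
  ∀ (b : α) (B : Set (Set α)), IsLocalPiBase B b → ¬ B.Countable

/-- An independent family on ω. -/
def IsIndepFamily (B : Set (Set ℕ)) : Prop :=
  (∀ A ∈ B, A.Infinite) ∧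
    ∀ F G : Finset (Set ℕ), ↑F ⊆ B → ↑G ⊆ B → Disjoint F G →
      ((⋂ A ∈ F, A) ∩ ⋂ A ∈ G, (Set.univ \ A)).Infinite

def SeparatesPointsFam (B : Set (Set ℕ)) : Prop :=
  ∀ m n : ℕ, m ≠ n → ∃ A ∈ B, m ∈ A ∧ n ∉ A

/-- The envelope of an independent family: finite Boolean combinations. -/
def envSets (B : Set (Set ℕ)) : Set (Set ℕ) :=
  {V : Set ℕ | ∃ F G : Finset (Set ℕ), ↑F ⊆ B ∧ ↑G ⊆ B ∧ Disjoint F G ∧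
    V = (⋂ A ∈ F, A) ∩ ⋂ A ∈ G, (Set.univ \ A)}

/-- The topology on ω generated by the envelope of `B`. -/
def XBtop (B : Set (Set ℕ)) : TopologicalSpace ℕ :=
  TopologicalSpace.generateFrom (envSets B)

/-- The ideal of nowhere dense subsets of the space `X(B)`. -/
def nwdXB (B : Set (Set ℕ)) : Set (Set ℕ) :=
  {A : Set ℕ | @IsNowhereDense ℕ (XBtop B) A}

/-- `non*(ED_fin)`. -/
noncomputable def nonStarEDfin : Cardinal :=
  sInf {c : Cardinal | ∃ H : Set (Set ↥Delta),
    (∀ A ∈ H, A.Infinite) ∧ (∀ A ∈ EDfin, ∃ B ∈ H, (A ∩ B).Finite) ∧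
    Cardinal.mk H = c}

open Filter Topology

section

variable {α : Type*} [TopologicalSpace α]

theorem UncountablePiCharEverywhere.neBot_nhdsNE (hπ : UncountablePiCharEverywhere α) (x : α) :
    (𝓝[≠] x).NeBot := by
  rw [neBot_iff]
  intro h
  rw [← isOpen_singleton_iff_punctured_nhds] at h
  refine hπ x {{x}} ⟨?_, fun V _ hx => ⟨{x}, rfl, singleton_subset_iff.2 hx⟩⟩
    (countable_singleton _)
  rintro _ rfl
  exact ⟨h, singleton_nonempty x⟩

/-- A clopen set can be enlarged to a clopen neighbourhood of a given point without swallowing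
any member of a countable family of open sets. -/
theorem UncountablePiCharEverywhere.exists_isClopen_superset
    (hπ : UncountablePiCharEverywhere α) (hz : ZeroDimensional α) {V : ℕ → Set α}
    (hV : ∀ n, IsOpen (V n)) {C : Set α} (hC : IsClopen C) (hVC : ∀ n, (V n \ C).Nonempty)
    (x : α) :
    ∃ C' : Set α, IsClopen C' ∧ (∀ n, (V n \ C').Nonempty) ∧ C ⊆ C' ∧ x ∈ C' := by
  by_contra! hcon
  refine hπ x (range fun n => V n \ C) ⟨?_, fun O hO hx => ?_⟩ (countable_range _)
  · rintro _ ⟨n, rfl⟩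
    exact ⟨(hV n).sdiff hC.isClosed, hVC n⟩
  · obtain ⟨W, hW, hxW, hWO⟩ := hz.exists_subset_of_mem_open hx hO
    by_contra! hno
    refine hcon (C ∪ W) (hC.union hW) (fun n => ?_) subset_union_left (Or.inr hxW)
    obtain ⟨y, hy, hyO⟩ := not_subset.1 (hno _ ⟨n, rfl⟩)
    exact ⟨y, hy.1, fun h => h.elim hy.2 fun h => hyO (hWO h)⟩

theorem exists_isNowhereDense_forall_inter_nonempty [T1Space α] [Countable α] [Nonempty α]
    (hz : ZeroDimensional α) (hπ : UncountablePiCharEverywhere α) (D : ℕ → Set α)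
    (hD : ∀ n, ¬ IsNowhereDense (D n)) :
    ∃ A : Set α, IsNowhereDense A ∧ ∀ n, (A ∩ D n).Nonempty := by
  have := hπ.neBot_nhdsNE
  obtain ⟨x, hx⟩ := exists_surjective_nat α
  let V : ℕ → Set α := fun n => interior (closure (D n))
  have hV : ∀ n, IsOpen (V n) := fun n => isOpen_interior
  let G := {C : Set α // IsClopen C ∧ ∀ n, (V n \ C).Nonempty}
  have hstep : ∀ (C : G) (y : α), ∃ C' : G, C.1 ⊆ C'.1 ∧ y ∈ C'.1 := fun C y => by
    obtain ⟨C', h₁, h₂, h₃, h₄⟩ := hπ.exists_isClopen_superset hz hV C.2.1 C.2.2 y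
    exact ⟨⟨C', h₁, h₂⟩, h₃, h₄⟩
  choose next hnext hmem using hstep
  let C₀ : G := ⟨∅, isClopen_empty, fun n => by
    rw [sdiff_empty]
    exact nonempty_iff_ne_empty.2 (hD n)⟩
  let C : ℕ → G := fun n => Nat.rec C₀ (fun n c => next c (x n)) n
  have hCmono : Monotone fun n => (C n).1 :=
    monotone_nat_of_le_succ fun n => hnext (C n) (x n)
  have hxC : ∀ n, x n ∈ (C (n + 1)).1 := fun n => hmem (C n) (x n)
  have ha : ∀ n, (D n \ (C n).1).Nonempty := fun n => by
    obtain ⟨y, hyV, hyC⟩ := (C n).2.2 n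
    obtain ⟨z, hzC, hzD⟩ := mem_closure_iff.1 (interior_subset hyV) _
      (C n).2.1.compl.isOpen hyC
    exact ⟨z, hzD, hzC⟩
  choose a haD haC using ha
  refine ⟨range a, ?_, fun n => ⟨a n, ⟨n, rfl⟩, haD n⟩⟩
  rw [IsNowhereDense, eq_empty_iff_forall_notMem]
  intro y hy
  obtain ⟨i, rfl⟩ := hx y
  have hopen : IsOpen (C (i + 1)).1 := (C (i + 1)).2.1.isOpen
  have hfin : ((C (i + 1)).1 ∩ range a).Finite := by
    refine ((finite_lt_nat (i + 1)).image a).subset ?_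
    rintro _ ⟨hn, n, rfl⟩
    refine ⟨n, ?_, rfl⟩
    by_contra! h
    exact haC n (hCmono (not_lt.1 h) hn)
  have hsub : (C (i + 1)).1 ∩ interior (closure (range a)) ⊆ (C (i + 1)).1 ∩ range a := by
    refine ((inter_subset_inter_right _ interior_subset).trans hopen.inter_closure).trans ?_
    rw [hfin.isClosed.closure_eq]
  exact infinite_of_mem_nhds (x i)
    ((hopen.inter isOpen_interior).mem_nhds ⟨hxC i, hy⟩) (hfin.subset hsub)

/-- In a Hausdorff Fréchet space without isolated points, a point can be approached by a sequence
that eventually enters each of countably many decreasing sets dense near the point. -/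
theorem IsFrechet.exists_tendsto_eventually_mem [T2Space α] [∀ x : α, (𝓝[≠] x).NeBot]
    (hF : IsFrechet α) {V : Set α} (hV : IsOpen V) {E : ℕ → Set α} (hE : Antitone E)
    (hVE : ∀ k, V ⊆ closure (E k)) {x : α} (hx : x ∈ V) :
    ∃ u : ℕ → α, (∀ n, u n ∈ E 0) ∧ Tendsto u atTop (𝓝 x) ∧ ∀ k, ∀ᶠ n in atTop, u n ∈ E k := by
  have hxV : x ∈ closure (V \ {x}) := by
    rw [sdiff_eq]
    exact hV.inter_closure ⟨hx, by rw [closure_compl_singleton]; trivial⟩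
  obtain ⟨z, hzV, hzx⟩ := hF x _ hxV
  have hsep : ∀ k, ∃ O P : Set α, IsOpen O ∧ IsOpen P ∧ z k ∈ O ∧ x ∈ P ∧ Disjoint O P :=
    fun k => t2_separation (hzV k).2
  choose O P hO hP hzO hxP hOP using hsep
  have hxZ : x ∈ closure (⋃ k, E k ∩ O k) := by
    rw [mem_closure_iff]
    intro U hU hxU
    obtain ⟨k, hk⟩ := (hzx.eventually_mem (hU.mem_nhds hxU)).exists
    obtain ⟨w, ⟨hwU, hwO⟩, hwE⟩ := mem_closure_iff.1 (hVE k (hzV k).1) (U ∩ O k)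
      (hU.inter (hO k)) ⟨hk, hzO k⟩
    exact ⟨w, hwU, mem_iUnion.2 ⟨k, hwE, hwO⟩⟩
  obtain ⟨u, hu, hux⟩ := hF x _ hxZ
  simp only [mem_iUnion] at hu
  choose j hjE hjO using hu
  refine ⟨u, fun n => hE (Nat.zero_le _) (hjE n), hux, fun k => ?_⟩
  have hev : ∀ᶠ n in atTop, ∀ i ∈ Iio k, u n ∈ P i :=
    (eventually_all_finite (finite_Iio k)).2 fun i _ =>
      hux.eventually_mem ((hP i).mem_nhds (hxP i))
  filter_upwards [hev] with n hn
  refine hE ?_ (hjE n)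
  by_contra! h
  exact (hOP (j n)).notMem_of_mem_left (hjO n) (hn _ h)

theorem IsOpen.subset_closure_of_subset_closure_union {V E N : Set α} (hV : IsOpen V)
    (hN : IsNowhereDense N) (h : V ⊆ closure (E ∪ N)) : V ⊆ closure E := by
  rw [closure_union] at h
  have h' : V \ closure E ⊆ interior (closure N) :=
    interior_maximal (sdiff_subset_iff.2 h) (hV.sdiff isClosed_closure)
  rw [hN] at h'
  exact sdiff_eq_empty.1 (subset_empty_iff.1 h')

end

theorem setOf_fst_lt_mem_ED (k : ℕ) : {p : ℕ × ℕ | p.1 < k} ∈ ED := by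
  classical
  refine ⟨(Finset.range k).image fun n => {p : ℕ × ℕ | p.1 = n}, ∅, ?_, finite_empty, ?_⟩
  · intro C hC
    obtain ⟨n, -, rfl⟩ := Finset.mem_image.1 (Finset.mem_coe.1 hC)
    exact Or.inl ⟨n, rfl⟩
  · intro p hp
    exact Or.inr ⟨{q | q.1 = p.1}, Finset.mem_coe.2
      (Finset.mem_image.2 ⟨p.1, Finset.mem_range.2 hp, rfl⟩), rfl⟩

theorem graph_mem_ED (g : ℕ → ℕ) : {p : ℕ × ℕ | p.2 = g p.1} ∈ ED := by
  refine ⟨{{p : ℕ × ℕ | p.2 = g p.1}}, ∅, ?_, finite_empty, ?_⟩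
  · rw [Finset.coe_singleton, singleton_subset_iff]
    exact Or.inr ⟨g, rfl⟩
  · rw [Finset.coe_singleton, sUnion_singleton]
    exact subset_union_right

theorem exists_le_strictMono_of_tendsto (c : ℕ → ℕ → ℕ) (k : ℕ → ℕ)
    (hc : ∀ i, Tendsto (c i) atTop atTop) :
    ∃ j : ℕ → ℕ, (∀ i, k i ≤ j i) ∧ StrictMono fun i => c i (j i) := by
  have h : ∀ i m, ∃ j, k i ≤ j ∧ m < c i j := fun i m =>
    ((eventually_ge_atTop (k i)).and ((hc i).eventually_gt_atTop m)).exists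
  choose s hs hlt using h
  let j : ℕ → ℕ := fun i => Nat.rec (s 0 0) (fun i m => s (i + 1) (c i m)) i
  refine ⟨j, fun i => ?_, strictMono_nat_of_lt_succ fun i => hlt (i + 1) (c i (j i))⟩
  cases i with
  | zero => exact hs 0 0
  | succ i => exact hs (i + 1) _

/-- a countably infinite Hausdorff zero-dimensional Fréchet space with
uncountable π-character everywhere gives a counterexample to the Category Dichotomy. -/
theorem stmt15 {α : Type} [TopologicalSpace α] [T2Space α] [Countable α] [Infinite α]
    (hz : ZeroDimensional α) (hF : IsFrechet α) (hπ : UncountablePiCharEverywhere α) :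
    ¬ KatetovLE {A : Set α | IsNowhereDense A} nwdQ ∧
      ∀ Y : Set α, ¬ IsNowhereDense Y →
        ¬ KatetovLE ED (restrictIdeal {A : Set α | IsNowhereDense A} Y) := by
  have hne : ∀ x : α, (𝓝[≠] x).NeBot := hπ.neBot_nhdsNE
  constructor
  · rintro ⟨f, hf⟩
    obtain ⟨b, hbc, hbe, hb⟩ := TopologicalSpace.exists_countable_basis ℚ
    have hbne : b.Nonempty := by
      obtain ⟨v, hv, -⟩ := hb.exists_subset_of_mem_open (mem_univ (0 : ℚ)) isOpen_univ
      exact ⟨v, hv⟩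
    obtain ⟨U, rfl⟩ := hbc.exists_eq_range hbne
    obtain ⟨A, hA, hmeet⟩ := exists_isNowhereDense_forall_inter_nonempty hz hπ
      (fun n => f '' U n) fun n hn => by
        have hUn : (U n).Nonempty := by
          rw [nonempty_iff_ne_empty]
          exact fun h => hbe ⟨n, h⟩
        have h : IsNowhereDense (U n) := (hf _ hn).mono (subset_preimage_image f (U n))
        have h' := (hb.isOpen ⟨n, rfl⟩).subset_interior_iff.2 (subset_closure (s := U n))
        rw [h] at h'
        exact hUn.ne_empty (subset_empty_iff.1 h')
    have hd : Dense (f ⁻¹' A) := by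
      rw [hb.dense_iff]
      rintro _ ⟨n, rfl⟩ -
      obtain ⟨_, hxA, y, hy, rfl⟩ := hmeet n
      exact ⟨y, hy, hxA⟩
    have h : interior (closure (f ⁻¹' A)) = ∅ := hf A hA
    rw [hd.closure_eq, interior_univ] at h
    exact univ_nonempty.ne_empty h
  · rintro Y hY ⟨f, hf⟩
    let E : ℕ → Set α := fun k => Subtype.val '' {y : Y | k ≤ (f y).1}
    have hE : Antitone E := fun k l hkl =>
      image_mono fun y (hy : l ≤ (f y).1) => hkl.trans hy
    set V := interior (closure Y)
    have hVne : V.Nonempty := nonempty_iff_ne_empty.2 hY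
    have hVE : ∀ k, V ⊆ closure (E k) := fun k => by
      refine isOpen_interior.subset_closure_of_subset_closure_union
        (hf _ (setOf_fst_lt_mem_ED k)) (interior_subset.trans (closure_mono fun y hy => ?_))
      rcases le_or_gt k (f ⟨y, hy⟩).1 with h | h
      · exact Or.inl ⟨⟨y, hy⟩, h, rfl⟩
      · exact Or.inr ⟨⟨y, hy⟩, h, rfl⟩
    have hseq : ∀ x : V, ∃ u : ℕ → Y, Tendsto (fun n => (u n : α)) atTop (𝓝 (x : α)) ∧
        Tendsto (fun n => (f (u n)).1) atTop atTop := by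
      rintro ⟨x, hx⟩
      obtain ⟨u, hu, hux, huE⟩ := hF.exists_tendsto_eventually_mem isOpen_interior hE hVE hx
      have huY : ∀ n, u n ∈ Y := fun n => by
        obtain ⟨y, -, hy⟩ := hu n
        exact hy ▸ y.2
      refine ⟨fun n => ⟨u n, huY n⟩, hux, tendsto_atTop.2 fun k => ?_⟩
      filter_upwards [huE k] with n hn
      obtain ⟨y, hy, hyu⟩ := hn
      have : y = ⟨u n, huY n⟩ := Subtype.ext hyu
      exact this ▸ hy
    choose u hu hcol using hseq
    have : Nonempty V := hVne.to_subtype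
    obtain ⟨e, he⟩ := exists_surjective_nat (V × ℕ)
    obtain ⟨j, hj, hmono⟩ := exists_le_strictMono_of_tendsto
      (fun i n => (f (u (e i).1 n)).1) (fun i => (e i).2) (fun i => hcol (e i).1)
    obtain ⟨g, hg⟩ : ∃ g : ℕ → ℕ, ∀ i,
        g (f (u (e i).1 (j i))).1 = (f (u (e i).1 (j i))).2 :=
      ⟨Function.extend (fun i => (f (u (e i).1 (j i))).1)
        (fun i => (f (u (e i).1 (j i))).2) 0, fun i => hmono.injective.extend_apply _ _ i⟩
    have hA : IsNowhereDense (Subtype.val '' (f ⁻¹' {p : ℕ × ℕ | p.2 = g p.1})) :=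
      hf _ (graph_mem_ED g)
    have hsub : V ⊆ closure (Subtype.val '' (f ⁻¹' {p : ℕ × ℕ | p.2 = g p.1})) := by
      intro x hx
      rw [mem_closure_iff_nhds]
      intro O hO
      obtain ⟨k, hk⟩ := eventually_atTop.1 ((hu ⟨x, hx⟩).eventually_mem hO)
      obtain ⟨i, hi⟩ := he (⟨x, hx⟩, k)
      have hji := hj i
      have hgi := hg i
      rw [hi] at hji hgi
      exact ⟨_, hk _ hji, _, hgi.symm, rfl⟩
    have h := interior_maximal hsub isOpen_interior
    rw [hA] at h
    exact hVne.ne_empty (subset_empty_iff.1 h)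
end

section
/- Let B be an uncountable independent family on ω that separates points. Then every point of the space X(B) has π-character exactly |B|: the least cardinality of a local π-base at any point of X(B) equals the cardinality of B. In particular, X(B) has uncountable π-character everywhere. -/
open Cardinal Set

/-- The basic neighbourhood of `x` in `X(B)` determined by a finite set `S` of members of `B`:
the points lying in the same members of `S` as `x`. -/
def cylinderAt (S : Finset (Set ℕ)) (x : ℕ) : Set ℕ := {n | ∀ A ∈ S, n ∈ A ↔ x ∈ A}

open Classical in
lemma cylinderAt_eq (S : Finset (Set ℕ)) (x : ℕ) :
    cylinderAt S x = (⋂ A ∈ S.filter (fun A => x ∈ A), A) ∩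
      ⋂ A ∈ S.filter (fun A => x ∉ A), (Set.univ \ A) := by
  ext n
  simp only [cylinderAt, Set.mem_ofPred_eq, Set.mem_inter_iff, Set.mem_iInter, Finset.mem_filter,
    Set.mem_sdiff, Set.mem_univ, true_and]
  grind

lemma cylinderAt_mem_envSets {B : Set (Set ℕ)} {S : Finset (Set ℕ)} (hS : ↑S ⊆ B) (x : ℕ) :
    cylinderAt S x ∈ envSets B := by
  classical
  refine ⟨S.filter (fun A => x ∈ A), S.filter (fun A => x ∉ A), ?_, ?_,
    Finset.disjoint_filter_filter_not _ _ _, cylinderAt_eq S x⟩ <;>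
  · intro A hA
    exact hS (Finset.mem_filter.1 hA).1

lemma isOpen_cylinderAt {B : Set (Set ℕ)} {S : Finset (Set ℕ)} (hS : ↑S ⊆ B) (x : ℕ) :
    @IsOpen ℕ (XBtop B) (cylinderAt S x) :=
  TopologicalSpace.isOpen_generateFrom_of_mem (cylinderAt_mem_envSets hS x)

lemma mem_cylinderAt_self (S : Finset (Set ℕ)) (x : ℕ) : x ∈ cylinderAt S x :=
  fun _ _ => Iff.rfl

lemma cylinderAt_anti {S T : Finset (Set ℕ)} (h : S ⊆ T) (x : ℕ) :
    cylinderAt T x ⊆ cylinderAt S x :=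
  fun _ hn A hA => hn A (h hA)

lemma exists_cylinderAt_subset {B : Set (Set ℕ)} {V : Set ℕ} (hV : @IsOpen ℕ (XBtop B) V) {x : ℕ}
    (hx : x ∈ V) : ∃ S : Finset (Set ℕ), ↑S ⊆ B ∧ cylinderAt S x ⊆ V := by
  classical
  have hV' : TopologicalSpace.GenerateOpen (envSets B) V := hV
  clear hV
  induction hV' with
  | basic V hV =>
    obtain ⟨F, G, hF, hG, -, rfl⟩ := hV
    refine ⟨F ∪ G, by simp [hF, hG], fun n hn => ?_⟩
    simp only [cylinderAt, Set.mem_ofPred_eq, Finset.mem_union] at hn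
    simp only [Set.mem_inter_iff, Set.mem_iInter, Set.mem_sdiff, Set.mem_univ, true_and] at hx ⊢
    exact ⟨fun A hA => (hn A (Or.inl hA)).2 (hx.1 A hA),
      fun A hA h => hx.2 A hA ((hn A (Or.inr hA)).1 h)⟩
  | univ => exact ⟨∅, by simp, Set.subset_univ _⟩
  | inter U W _ _ ihU ihW =>
    obtain ⟨S, hS, hSU⟩ := ihU hx.1
    obtain ⟨T, hT, hTW⟩ := ihW hx.2
    exact ⟨S ∪ T, by simp [hS, hT], Set.subset_inter
      ((cylinderAt_anti Finset.subset_union_left x).trans hSU)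
      ((cylinderAt_anti Finset.subset_union_right x).trans hTW)⟩
  | sUnion 𝒱 _ ih =>
    obtain ⟨W, hW, hxW⟩ := hx
    obtain ⟨S, hS, hSW⟩ := ih W hW hxW
    exact ⟨S, hS, hSW.trans (Set.subset_sUnion_of_mem hW)⟩

/-- In an independent family, a cylinder inside a side of `A` must mention `A`. -/
lemma mem_of_cylinderAt_subset {B : Set (Set ℕ)} (hB : IsIndepFamily B) {S : Finset (Set ℕ)}
    (hS : ↑S ⊆ B) {A : Set ℕ} (hA : A ∈ B) {x b : ℕ}
    (h : cylinderAt S x ⊆ cylinderAt {A} b) : A ∈ S := by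
  classical
  by_contra hAS
  have key : ∃ n ∈ cylinderAt S x, ¬ (n ∈ A ↔ b ∈ A) := by
    have hF : ∀ (p : Set ℕ → Prop) [DecidablePred p], ↑(S.filter p) ⊆ B := fun p _ C hC =>
      hS (Finset.mem_filter.1 hC).1
    have hdisj : Disjoint (S.filter (fun C => x ∈ C)) (S.filter (fun C => x ∉ C)) :=
      Finset.disjoint_filter_filter_not _ _ _
    rw [cylinderAt_eq]
    by_cases hb : b ∈ A
    · obtain ⟨n, hn⟩ := (hB.2 (S.filter (fun C => x ∈ C)) (insert A (S.filter (fun C => x ∉ C)))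
        (hF _) (by rw [Finset.coe_insert]; exact Set.insert_subset hA (hF _))
        (by rw [Finset.disjoint_insert_right]; exact ⟨by simp [hAS], hdisj⟩)).nonempty
      rw [Finset.set_biInter_insert] at hn
      exact ⟨n, ⟨hn.1, hn.2.2⟩, fun h => hn.2.1.2 (h.2 hb)⟩
    · obtain ⟨n, hn⟩ := (hB.2 (insert A (S.filter (fun C => x ∈ C))) (S.filter (fun C => x ∉ C))
        (by rw [Finset.coe_insert]; exact Set.insert_subset hA (hF _)) (hF _)
        (by rw [Finset.disjoint_insert_left]; exact ⟨by simp [hAS], hdisj⟩)).nonempty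
      rw [Finset.set_biInter_insert] at hn
      exact ⟨n, ⟨hn.1.2, hn.2⟩, fun h => hb (h.1 hn.1.1)⟩
  obtain ⟨n, hn, hnA⟩ := key
  exact hnA (h hn A (Finset.mem_singleton_self A))

lemma mk_le_mk_of_isLocalPiBase {B : Set (Set ℕ)} (hB : IsIndepFamily B) (hunc : ¬ B.Countable)
    {b : ℕ} {U : Set (Set ℕ)} (hU : @IsLocalPiBase ℕ (XBtop B) U b) : #B ≤ #U := by
  have hex : ∀ u : U, ∃ (x : ℕ) (S : Finset (Set ℕ)), ↑S ⊆ B ∧ cylinderAt S x ⊆ u := fun u => by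
    obtain ⟨x, hx⟩ := (hU.1 u u.2).2
    exact ⟨x, exists_cylinderAt_subset (hU.1 u u.2).1 hx⟩
  choose x S hSB hSu using hex
  have hcover : B ⊆ ⋃ u : U, (S u : Set (Set ℕ)) := fun A hA => by
    obtain ⟨u, hu, huA⟩ := hU.2 (cylinderAt {A} b)
      (isOpen_cylinderAt (B := B) (S := {A}) (by simpa using hA) b) (mem_cylinderAt_self _ b)
    exact Set.mem_iUnion.2 ⟨⟨u, hu⟩,
      mem_of_cylinderAt_subset hB (hSB ⟨u, hu⟩) hA ((hSu ⟨u, hu⟩).trans huA)⟩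
  have hinf : ℵ₀ ≤ #U := by
    by_contra! hlt
    have : Countable U := Cardinal.mk_le_aleph0_iff.1 hlt.le
    exact hunc ((Set.countable_iUnion fun u => (S u).countable_toSet).mono hcover)
  calc #B ≤ #(⋃ u : U, (S u : Set (Set ℕ))) := Cardinal.mk_le_mk_of_subset hcover
    _ ≤ #U * ⨆ u : U, #(S u : Set (Set ℕ)) := Cardinal.mk_iUnion_le _
    _ ≤ #U * ℵ₀ := by
      gcongr
      exact ciSup_le' fun u => (Cardinal.mk_le_aleph0_iff.2 (S u).countable_toSet)
    _ = #U := Cardinal.mul_aleph0_eq hinf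

lemma exists_isLocalPiBase_mk_le {B : Set (Set ℕ)} (hunc : ¬ B.Countable) (b : ℕ) :
    ∃ U : Set (Set ℕ), @IsLocalPiBase ℕ (XBtop B) U b ∧ #U ≤ #B := by
  classical
  have : Infinite B := Set.infinite_coe_iff.2 fun h => hunc h.countable
  have himage : ∀ T : Finset B, ↑(T.image Subtype.val) ⊆ B := fun T A hA => by
    obtain ⟨A', -, rfl⟩ := Finset.mem_image.1 hA
    exact A'.2
  refine ⟨Set.range fun T : Finset B => cylinderAt (T.image Subtype.val) b, ⟨?_, ?_⟩, ?_⟩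
  · rintro _ ⟨T, rfl⟩
    exact ⟨isOpen_cylinderAt (himage T) b, b, mem_cylinderAt_self _ b⟩
  · intro V hV hb
    obtain ⟨S, hS, hSV⟩ := exists_cylinderAt_subset hV hb
    refine ⟨_, ⟨S.subtype (· ∈ B), rfl⟩, Set.Subset.trans (cylinderAt_anti ?_ b) hSV⟩
    intro A hA
    exact Finset.mem_image.2 ⟨⟨A, hS hA⟩, by simpa using hA, rfl⟩
  · exact Cardinal.mk_range_le.trans (Cardinal.mk_finset_of_infinite B).le

/-- for an uncountable independent family `B` separating points, every
point of `X(B)` has π-character exactly `|B|`; in particular `X(B)` has uncountable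
π-character everywhere. -/
theorem stmt16 (B : Set (Set ℕ)) (hB : IsIndepFamily B) (hsep : SeparatesPointsFam B)
    (hunc : ¬ B.Countable) :
    (∀ b : ℕ, sInf {c : Cardinal | ∃ U : Set (Set ℕ),
        @IsLocalPiBase ℕ (XBtop B) U b ∧ Cardinal.mk U = c} = Cardinal.mk B) ∧
      @UncountablePiCharEverywhere ℕ (XBtop B) := by
  refine ⟨fun b => le_antisymm ?_ ?_, fun b U hU hc => ?_⟩
  · obtain ⟨U, hU, hle⟩ := exists_isLocalPiBase_mk_le hunc b
    refine le_trans (csInf_le' ?_) hle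
    exact ⟨U, hU, rfl⟩
  · obtain ⟨U, hU, -⟩ := exists_isLocalPiBase_mk_le hunc b
    refine le_csInf ⟨#U, U, hU, rfl⟩ ?_
    rintro _ ⟨W, hW, rfl⟩
    exact mk_le_mk_of_isLocalPiBase hB hunc hW
  · exact hunc (Cardinal.le_aleph0_iff_set_countable.1
      ((mk_le_mk_of_isLocalPiBase hB hunc hU).trans (Cardinal.le_aleph0_iff_set_countable.2 hc)))
end

section
/- Let B be an independent family on ω that separates points with |B| < non*(ED_fin). Then nwd(X(B)) is a Q⁺-ideal. -/
open Cardinal Set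

lemma IsNowhereDense.union {α : Type*} [TopologicalSpace α] {s t : Set α}
    (hs : IsNowhereDense s) (ht : IsNowhereDense t) : IsNowhereDense (s ∪ t) := by
  unfold IsNowhereDense at *
  rw [closure_union, interior_union_isClosed_of_interior_empty isClosed_closure ht, hs]

lemma IsNowhereDense.biUnion_finset {α ι : Type*} [TopologicalSpace α] (S : Finset ι)
    (f : ι → Set α) (h : ∀ i ∈ S, IsNowhereDense (f i)) :
    IsNowhereDense (⋃ i ∈ S, f i) := by
  classical
  induction S using Finset.induction_on with
  | empty => simp [isNowhereDense_empty]
  | insert a S _ ih =>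
    rw [Finset.set_biUnion_insert]
    exact (h a (Finset.mem_insert_self a S)).union
      (ih fun i hi => h i (Finset.mem_insert_of_mem hi))

lemma isTopologicalBasis_envSets (B : Set (Set ℕ)) :
    @TopologicalSpace.IsTopologicalBasis ℕ (XBtop B) (envSets B) := by
  classical
  let _ := XBtop B
  refine ⟨?_, ?_, rfl⟩
  · rintro _ ⟨F, G, hF, hG, -, rfl⟩ _ ⟨F', G', hF', hG', -, rfl⟩ x ⟨⟨h1, h2⟩, h3, h4⟩
    simp only [mem_iInter, mem_sdiff, mem_univ, true_and] at h1 h2 h3 h4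
    refine ⟨_, ⟨F ∪ F', G ∪ G', by simp [hF, hF'], by simp [hG, hG'], ?_, rfl⟩, ?_, ?_⟩
    · rw [Finset.disjoint_left]
      intro A hA hA'
      rcases Finset.mem_union.1 hA with h | h <;> rcases Finset.mem_union.1 hA' with h' | h' <;>
        grind
    · simp only [mem_inter_iff, mem_iInter, mem_sdiff, mem_univ, true_and, Finset.mem_union]
      grind
    · intro y
      simp only [mem_inter_iff, mem_iInter, mem_sdiff, mem_univ, true_and, Finset.mem_union]
      grind
  · exact eq_univ_of_univ_subset (subset_sUnion_of_mem ⟨∅, ∅, by simp⟩)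

lemma IsIndepFamily.infinite_of_mem_envSets {B : Set (Set ℕ)} (hB : IsIndepFamily B)
    {V : Set ℕ} (hV : V ∈ envSets B) : V.Infinite := by
  obtain ⟨F, G, hF, hG, hd, rfl⟩ := hV
  exact hB.2 F G hF hG hd

lemma SeparatesPointsFam.t1Space {B : Set (Set ℕ)} (hsep : SeparatesPointsFam B) :
    @T1Space ℕ (XBtop B) := by
  let _ := XBtop B
  rw [t1Space_iff_exists_open]
  intro m n hmn
  obtain ⟨A, hA, hm, hn⟩ := hsep m n hmn
  refine ⟨A, (isTopologicalBasis_envSets B).isOpen ⟨{A}, ∅, by simpa, by simp, by simp, ?_⟩, hm, hn⟩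
  simp

lemma SeparatesPointsFam.infinite {B : Set (Set ℕ)} (hsep : SeparatesPointsFam B) :
    B.Infinite := by
  intro hfin
  have hinj : Function.Injective fun n : ℕ => {A ∈ B | n ∈ A} := by
    intro m n h
    by_contra hmn
    obtain ⟨A, hA, hm, hn⟩ := hsep m n hmn
    have : A ∈ {A ∈ B | n ∈ A} := h.subset ⟨hA, hm⟩
    exact hn this.2
  exact infinite_range_of_injective hinj
    (hfin.finite_subsets.subset (range_subset_iff.2 fun n => sep_subset _ _))

lemma mk_envSets_le {B : Set (Set ℕ)} (hB : B.Infinite) : #(envSets B) ≤ #B := by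
  classical
  have := hB.to_subtype
  let g : Finset B × Finset B → Set ℕ := fun p =>
    (⋂ A ∈ p.1.map (Function.Embedding.subtype _), A) ∩
      ⋂ A ∈ p.2.map (Function.Embedding.subtype _), (Set.univ \ A)
  have hsub : envSets B ⊆ range g := by
    rintro _ ⟨F, G, hF, hG, -, rfl⟩
    refine ⟨(F.subtype (· ∈ B), G.subtype (· ∈ B)), ?_⟩
    simp only [g]
    rw [Finset.subtype_map_of_mem hF, Finset.subtype_map_of_mem hG]
  calc #(envSets B) ≤ #(range g) := mk_le_mk_of_subset hsub
    _ ≤ #(Finset B × Finset B) := mk_range_le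
    _ = #B := by
      rw [← mul_def, mk_finset_of_infinite, mul_eq_self (aleph0_le_mk _)]

lemma isNowhereDense_of_finite {B : Set (Set ℕ)} (hB : IsIndepFamily B)
    (hsep : SeparatesPointsFam B) {T : Set ℕ} (hT : T.Finite) :
    @IsNowhereDense ℕ (XBtop B) T := by
  let _ := XBtop B
  have : T1Space ℕ := hsep.t1Space
  rw [hT.isClosed.isNowhereDense_iff, eq_empty_iff_forall_notMem]
  intro x hx
  obtain ⟨V, hV, -, hVT⟩ :=
    (isTopologicalBasis_envSets B).exists_subset_of_mem_open hx isOpen_interior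
  exact hB.infinite_of_mem_envSets hV (hT.subset (hVT.trans interior_subset))

lemma infinite_inter_of_subset_closure {B : Set (Set ℕ)} (hB : IsIndepFamily B)
    (hsep : SeparatesPointsFam B) {X V : Set ℕ} (hV : V ∈ envSets B)
    (hVX : V ⊆ @closure ℕ (XBtop B) X) : (X ∩ V).Infinite := by
  let _ := XBtop B
  have : T1Space ℕ := hsep.t1Space
  intro hfin
  obtain ⟨x, hxV, hx⟩ := (hB.infinite_of_mem_envSets hV).exists_notMem_finite hfin
  obtain ⟨y, ⟨hyV, hy⟩, hyX⟩ := mem_closure_iff.1 (hVX hxV) (V \ (X ∩ V))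
    (((isTopologicalBasis_envSets B).isOpen hV).sdiff hfin.isClosed) ⟨hxV, hx⟩
  exact hy ⟨hyX, hyV⟩

lemma exists_mem_EDfin_of_mk_lt {H : Set (Set Delta)} (hH : ∀ A ∈ H, A.Infinite)
    (hcard : #H < nonStarEDfin) : ∃ A ∈ EDfin, ∀ C ∈ H, (A ∩ C).Infinite := by
  by_contra! h
  exact notMem_of_lt_csInf' hcard ⟨H, hH, h, rfl⟩

lemma finite_Delta_column (n : ℕ) : {p : Delta | p.1.1 = n}.Finite := by
  refine Finite.of_finite_image (f := Subtype.val)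
    (((finite_singleton n).prod (finite_Iic n)).subset ?_) Subtype.val_injective.injOn
  rintro _ ⟨⟨⟨a, b⟩, hab⟩, rfl, rfl⟩
  exact ⟨rfl, hab⟩

/-- An injection into `Δ` under which graphs of functions pull back to partial selectors of `P`,
that is, sets meeting every `P n` in at most one point. -/
lemma exists_injective_toDelta {X : Set ℕ} {P : ℕ → Set ℕ} (hfin : ∀ n, (P n).Finite)
    (hdisj : Pairwise (Function.onFun Disjoint P)) (hP : ⋃ n, P n = X) :
    ∃ e : X → Delta, Function.Injective e ∧ ∀ f : ℕ → ℕ, ∀ n,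
      (Subtype.val '' {x : X | (e x).1.2 = f (e x).1.1} ∩ P n).Subsingleton := by
  have hidx : ∀ x : X, ∃ n, x.1 ∈ P n := fun x => mem_iUnion.1 (hP.symm ▸ x.2)
  choose i hi using hidx
  have hbdd : ∀ n, ∃ b, ∀ x ∈ P n, x ≤ b := fun n => (hfin n).bddAbove
  choose b hb using hbdd
  refine ⟨fun x => ⟨(b (i x), x.1), hb _ _ (hi x)⟩, ?_, ?_⟩
  · intro x y h
    exact Subtype.ext (congrArg (fun p : Delta => p.1.2) h)
  · have huniq : ∀ (x : X) n, x.1 ∈ P n → i x = n := by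
      intro x n hx
      by_contra hne
      exact disjoint_left.1 (hdisj hne) (hi x) hx
    rintro f n _ ⟨⟨x, hx, rfl⟩, hxn⟩ _ ⟨⟨y, hy, rfl⟩, hyn⟩
    simp only [mem_ofPred_eq] at hx hy
    rw [hx, hy, huniq x n hxn, huniq y n hyn]

/-- if `|B| < non*(ED_fin)` then `nwd(X(B))` is a Q⁺-ideal. -/
theorem stmt17 (B : Set (Set ℕ)) (hB : IsIndepFamily B) (hsep : SeparatesPointsFam B)
    (hsize : Cardinal.mk B < nonStarEDfin) :
    IsQPlus (nwdXB B) := by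
  let _ := XBtop B
  intro X hX P hPfin hdisj hPX
  by_contra! hsel
  obtain ⟨e, he, hgraph⟩ := exists_injective_toDelta hPfin hdisj hPX
  let H : Set (Set Delta) :=
    (fun V : Set ℕ => e '' (Subtype.val ⁻¹' V)) '' {V ∈ envSets B | (X ∩ V).Infinite}
  have hHinf : ∀ C ∈ H, C.Infinite := by
    rintro _ ⟨V, ⟨-, hV⟩, rfl⟩
    refine Infinite.image he.injOn fun h => hV ?_
    rw [← Subtype.image_preimage_coe]
    exact h.image _
  have hHcard : #H < nonStarEDfin :=
    (mk_image_le.trans ((mk_le_mk_of_subset (sep_subset _ _)).trans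
      (mk_envSets_le hsep.infinite))).trans_lt hsize
  obtain ⟨A, ⟨S, F, hS, hF, hA⟩, hAH⟩ := exists_mem_EDfin_of_mk_lt hHinf hHcard
  have hnwd : IsNowhereDense (Subtype.val '' (e ⁻¹' A)) := by
    let T : Set (ℕ × ℕ) → Set ℕ := fun C => Subtype.val '' {x : X | (e x).1 ∈ C}
    have hinj : Function.Injective fun x : X => (e x).1 := Subtype.val_injective.comp he
    have hTF : IsNowhereDense (T F) :=
      isNowhereDense_of_finite hB hsep ((hF.preimage hinj.injOn).image _)
    have hTS : ∀ C ∈ S, IsNowhereDense (T C) := by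
      intro C hC
      rcases hS hC with ⟨n, rfl⟩ | ⟨f, rfl⟩
      · exact isNowhereDense_of_finite hB hsep
          (((finite_Delta_column n).preimage he.injOn).image _)
      · by_contra hT
        obtain ⟨n, hn⟩ := hsel _ hT (Subtype.coe_image_subset _ _)
        exact not_subsingleton_iff.2 hn (hgraph f n)
    refine (hTF.union (IsNowhereDense.biUnion_finset S T hTS)).mono ?_
    rintro _ ⟨x, hx, rfl⟩
    rcases hA (mem_image_of_mem Subtype.val hx) with h | ⟨C, hC, h⟩
    · exact Or.inl ⟨x, h, rfl⟩
    · exact Or.inr (mem_biUnion hC ⟨x, h, rfl⟩)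
  refine hX (subset_eq_empty (interior_maximal ?_ isOpen_interior) hnwd)
  intro x hx
  rw [mem_closure_iff]
  intro W hW hxW
  obtain ⟨V, hV, -, hVW⟩ := (isTopologicalBasis_envSets B).exists_subset_of_mem_open
    (show x ∈ W ∩ interior (closure X) from ⟨hxW, hx⟩) (hW.inter isOpen_interior)
  have hXV := infinite_inter_of_subset_closure hB hsep hV
    ((hVW.trans inter_subset_right).trans interior_subset)
  obtain ⟨_, hyA, y, hyV, rfl⟩ := (hAH _ ⟨V, ⟨hV, hXV⟩, rfl⟩).nonempty
  exact ⟨y, (hVW hyV).1, y, hyA, rfl⟩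
end
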